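/- For every element m of the monoid M there is exactly one representative word w_0 ∈ Σ* for m in which every pair of consecutive letters has one of the forms: c_i c_j with i ≥ j − 1; c_i t_j with i ≥ j − 1; t_i c_j with i ≥ j − 2; or t_i t_j with i ≥ j − 2. Moreover, this word w_0 is the lexicographically maximal representative of m with respect to the total order c_1 < t_1 < c_2 < t_2 < c_3 < t_3 < ⋯ on Σ. -/

import Mathlib

/-- The alphabet `Σ = {c_i : i ≥ 1} ∪ {t_i : i ≥ 1}` (where `t_i` stands for
`t_{i,i+1}`). -/
inductive Letter : Type
  | c (i : ℕ+)
  | t (i : ℕ+)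
  deriving DecidableEq

/-- The defining relations of the trace monoid `M`:
`c_i c_j = c_j c_i` for `|i - j| ≥ 2`; `c_i t_j = t_j c_i` for `i ≤ j - 2` or
`i ≥ j + 3`; `t_i t_j = t_j t_i` for `|i - j| ≥ 3`. -/
def SkelRel (u v : FreeMonoid Letter) : Prop :=
  (∃ i j : ℕ+, (i + 2 ≤ j ∨ j + 2 ≤ i) ∧
    u = FreeMonoid.of (.c i) * FreeMonoid.of (.c j) ∧
    v = FreeMonoid.of (.c j) * FreeMonoid.of (.c i)) ∨
  (∃ i j : ℕ+, (i + 2 ≤ j ∨ j + 3 ≤ i) ∧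
    u = FreeMonoid.of (.c i) * FreeMonoid.of (.t j) ∧
    v = FreeMonoid.of (.t j) * FreeMonoid.of (.c i)) ∨
  (∃ i j : ℕ+, (i + 3 ≤ j ∨ j + 3 ≤ i) ∧
    u = FreeMonoid.of (.t i) * FreeMonoid.of (.t j) ∧
    v = FreeMonoid.of (.t j) * FreeMonoid.of (.t i))

/-- The congruence on the free monoid `Σ*` generated by the partial commutation
relations. -/
def SkelCon : Con (FreeMonoid Letter) := conGen SkelRel

/-- The free partially commuting (trace) monoid `M`. -/
abbrev SkelMonoid : Type := SkelCon.Quotient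

/-- The image in `M` of a word in `Σ*`. -/
def toSkel (w : List Letter) : SkelMonoid := SkelCon.mk' (FreeMonoid.ofList w)

/-- The allowed pairs of consecutive letters in the canonical representative:
`c_i c_j` with `i ≥ j - 1`; `c_i t_j` with `i ≥ j - 1`; `t_i c_j` with `i ≥ j - 2`;
`t_i t_j` with `i ≥ j - 2`. -/
def GoodPair : Letter → Letter → Prop
  | .c i, .c j => j ≤ i + 1
  | .c i, .t j => j ≤ i + 1
  | .t i, .c j => j ≤ i + 2
  | .t i, .t j => j ≤ i + 2

/-- A word all of whose pairs of consecutive letters are allowed. -/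
def GoodWord (w : List Letter) : Prop :=
  ∀ (n : ℕ) (x y : Letter), w[n]? = some x → w[n + 1]? = some y → GoodPair x y

/-- The rank of a letter in the total order `c_1 < t_1 < c_2 < t_2 < ⋯` on `Σ`. -/
def letterRank : Letter → ℕ
  | .c i => 2 * (i : ℕ)
  | .t i => 2 * (i : ℕ) + 1

/-- The strict total order `c_1 < t_1 < c_2 < t_2 < ⋯` on `Σ`. -/
def LetterLT (x y : Letter) : Prop := letterRank x < letterRank y

/-- The left end of the interval of strands on which a letter acts: `c_i` acts on `[i, i + 1]`
and `t_i` on `[i, i + 2]`. Two letters commute exactly when their intervals are disjoint. -/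
def Letter.left : Letter → ℕ
  | .c i => i
  | .t i => i

/-- The right end of the interval of strands on which a letter acts. -/
def Letter.right : Letter → ℕ
  | .c i => i + 1
  | .t i => i + 2

theorem Letter.left_le_right (x : Letter) : x.left ≤ x.right := by
  cases x <;> simp [Letter.left, Letter.right]

theorem goodPair_iff (x y : Letter) : GoodPair x y ↔ ¬ x.right < y.left := by
  cases x <;> cases y <;>
    simp [GoodPair, Letter.left, Letter.right, ← PNat.coe_le_coe]

theorem letterLT_of_right_lt_left {x y : Letter} (h : x.right < y.left) : LetterLT x y := by
  cases x <;> cases y <;> simp only [LetterLT, letterRank, Letter.left, Letter.right] at * <;> omega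

theorem goodWord_nil : GoodWord [] := by
  intro n x y h
  simp at h

theorem goodWord_cons {x : Letter} {w : List Letter} :
    GoodWord (x :: w) ↔ (∀ y ∈ w.head?, GoodPair x y) ∧ GoodWord w := by
  constructor
  · intro h
    refine ⟨fun y hy => h 0 x y rfl ?_, fun n a b ha hb => h (n + 1) a b ha hb⟩
    rw [List.getElem?_cons_succ, ← List.head?_eq_getElem?]
    exact hy
  · rintro ⟨hx, hw⟩ (_ | n) a b ha hb
    · obtain rfl : x = a := by simpa using ha
      exact hx b (by rw [List.head?_eq_getElem?]; exact hb)
    · exact hw n a b ha hb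

theorem SkelRel.of_right_lt_left {x y : Letter} (h : x.right < y.left) :
    SkelRel (FreeMonoid.of x * FreeMonoid.of y) (FreeMonoid.of y * FreeMonoid.of x) ∨
      SkelRel (FreeMonoid.of y * FreeMonoid.of x) (FreeMonoid.of x * FreeMonoid.of y) := by
  rcases x with i | i <;> rcases y with j | j <;> simp only [Letter.left, Letter.right] at h
  · exact .inl (.inl ⟨i, j, .inl (by rw [← PNat.coe_le_coe, PNat.add_coe]; exact h), rfl, rfl⟩)
  · exact .inl (.inr (.inl ⟨i, j, .inl (by rw [← PNat.coe_le_coe, PNat.add_coe]; exact h), rfl, rfl⟩))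
  · exact .inr (.inr (.inl ⟨j, i, .inr (by rw [← PNat.coe_le_coe, PNat.add_coe]; exact h), rfl, rfl⟩))
  · exact .inl (.inr (.inr ⟨i, j, .inl (by rw [← PNat.coe_le_coe, PNat.add_coe]; exact h), rfl, rfl⟩))

theorem SkelRel.exists_disjoint {u v : FreeMonoid Letter} (h : SkelRel u v) :
    ∃ x y : Letter, (x.right < y.left ∨ y.right < x.left) ∧
      u = FreeMonoid.of x * FreeMonoid.of y ∧ v = FreeMonoid.of y * FreeMonoid.of x := by
  rcases h with ⟨i, j, h, hu, hv⟩ | ⟨i, j, h, hu, hv⟩ | ⟨i, j, h, hu, hv⟩ <;>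
    refine ⟨_, _, ?_, hu, hv⟩ <;>
    simp only [← PNat.coe_le_coe, PNat.add_coe, PNat.val_ofNat] at h <;>
    simp only [Letter.left, Letter.right] <;> omega

theorem toSkel_cons (x : Letter) (w : List Letter) :
    toSkel (x :: w) = SkelCon.mk' (FreeMonoid.of x) * toSkel w := by
  rw [toSkel, FreeMonoid.ofList_cons, map_mul, toSkel]

theorem toSkel_swap {x y : Letter} (h : x.right < y.left) (w : List Letter) :
    toSkel (x :: y :: w) = toSkel (y :: x :: w) := by
  have key : SkelCon.mk' (FreeMonoid.of x * FreeMonoid.of y) =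
      SkelCon.mk' (FreeMonoid.of y * FreeMonoid.of x) := by
    refine (Con.eq SkelCon).2 ?_
    rcases SkelRel.of_right_lt_left h with h | h
    · exact ConGen.Rel.of _ _ h
    · exact SkelCon.symm (ConGen.Rel.of _ _ h)
  simp only [toSkel_cons, ← mul_assoc, ← map_mul, key]

/-- Put a letter in front of a word and move it to the right until the pair it forms with the next
letter is allowed. -/
def insertLetter (x : Letter) : List Letter → List Letter
  | [] => [x]
  | y :: w => if x.right < y.left then y :: insertLetter x w else x :: y :: w

theorem insertLetter_comm_of_right_lt_left {x y : Letter} (h : x.right < y.left)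
    (w : List Letter) :
    insertLetter x (insertLetter y w) = insertLetter y (insertLetter x w) := by
  have hx := x.left_le_right
  have hy := y.left_le_right
  have hyx : ¬ y.right < x.left := by omega
  induction w with
  | nil => simp [insertLetter, h, hyx]
  | cons z w ih =>
    by_cases hyz : y.right < z.left
    · have hxz : x.right < z.left := by omega
      simp [insertLetter, hyz, hxz, ih]
    · by_cases hxz : x.right < z.left <;> simp [insertLetter, hyz, hxz, h, hyx]

theorem toSkel_insertLetter (x : Letter) (w : List Letter) :
    toSkel (insertLetter x w) = toSkel (x :: w) := by
  induction w with
  | nil => rfl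
  | cons y w ih =>
    by_cases h : x.right < y.left
    · rw [insertLetter, if_pos h, toSkel_swap h, toSkel_cons, ih, ← toSkel_cons]
    · rw [insertLetter, if_neg h]

theorem insertLetter_of_goodWord_cons {x : Letter} {w : List Letter} (h : GoodWord (x :: w)) :
    insertLetter x w = x :: w := by
  cases w with
  | nil => rfl
  | cons y w => exact if_neg ((goodPair_iff x y).1 ((goodWord_cons.1 h).1 y rfl))

theorem head?_insertLetter (x : Letter) (w : List Letter) :
    (insertLetter x w).head? = some x ∨ (insertLetter x w).head? = w.head? := by
  cases w with
  | nil => exact .inl rfl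
  | cons y w => by_cases h : x.right < y.left <;> simp [insertLetter, h]

theorem GoodWord.insertLetter {w : List Letter} (hw : GoodWord w) (x : Letter) :
    GoodWord (insertLetter x w) := by
  induction w with
  | nil => exact goodWord_cons.2 ⟨by simp, goodWord_nil⟩
  | cons y w ih =>
    have hyw := goodWord_cons.1 hw
    by_cases h : x.right < y.left
    · rw [_root_.insertLetter, if_pos h]
      refine goodWord_cons.2 ⟨fun z hz => ?_, ih hyw.2⟩
      rcases head?_insertLetter x w with hd | hd
      · obtain rfl : x = z := by simpa [hd] using hz
        rw [goodPair_iff]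
        have := x.left_le_right
        have := y.left_le_right
        omega
      · exact hyw.1 z (hd ▸ hz)
    · rw [_root_.insertLetter, if_neg h]
      refine goodWord_cons.2 ⟨fun z hz => ?_, hw⟩
      obtain rfl : y = z := by simpa using hz
      exact (goodPair_iff x y).2 h

theorem eq_or_lex_insertLetter (x : Letter) (w : List Letter) :
    x :: w = insertLetter x w ∨ List.Lex LetterLT (x :: w) (insertLetter x w) := by
  cases w with
  | nil => exact .inl rfl
  | cons y w =>
    by_cases h : x.right < y.left
    · rw [insertLetter, if_pos h]
      exact .inr (.rel (letterLT_of_right_lt_left h))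
    · exact .inl (if_neg h).symm

/-- The word obtained by inserting the letters of a word one after the other, from right to left. -/
def normalForm (w : List Letter) : List Letter := w.foldr insertLetter []

theorem toSkel_normalForm (w : List Letter) : toSkel (normalForm w) = toSkel w := by
  induction w with
  | nil => rfl
  | cons x w ih =>
    change toSkel (insertLetter x (normalForm w)) = _
    rw [toSkel_insertLetter, toSkel_cons, ih, ← toSkel_cons]

theorem goodWord_normalForm (w : List Letter) : GoodWord (normalForm w) := by
  induction w with
  | nil => exact goodWord_nil
  | cons x w ih => exact ih.insertLetter x

theorem GoodWord.normalForm_eq {w : List Letter} (hw : GoodWord w) : normalForm w = w := by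
  induction w with
  | nil => rfl
  | cons x w ih =>
    change _root_.insertLetter x (normalForm w) = _
    rw [ih (goodWord_cons.1 hw).2, insertLetter_of_goodWord_cons hw]

theorem letterLT_trans {x y z : Letter} (hxy : LetterLT x y) (hyz : LetterLT y z) :
    LetterLT x z :=
  Nat.lt_trans hxy hyz

theorem eq_or_lex_normalForm (w : List Letter) :
    w = normalForm w ∨ List.Lex LetterLT w (normalForm w) := by
  induction w with
  | nil => exact .inl rfl
  | cons x w ih =>
    change _ = insertLetter x (normalForm w) ∨ List.Lex _ _ (insertLetter x (normalForm w))
    rcases ih with ih | ih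
    · rw [← ih]
      exact eq_or_lex_insertLetter x w
    · have hlex : List.Lex LetterLT (x :: w) (x :: normalForm w) := .cons ih
      rcases eq_or_lex_insertLetter x (normalForm w) with h | h
      · exact .inr (h ▸ hlex)
      · exact .inr (List.lex_trans letterLT_trans hlex h)

/-- The action of words on words by insertion of letters. -/
def insertHom : FreeMonoid Letter →* Function.End (List Letter) :=
  FreeMonoid.lift insertLetter

theorem insertHom_ofList_nil (w : List Letter) :
    insertHom (FreeMonoid.ofList w) [] = normalForm w := by
  induction w with
  | nil => rfl
  | cons x w ih =>
    rw [FreeMonoid.ofList_cons, map_mul]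
    change insertLetter x (insertHom (FreeMonoid.ofList w) []) = _
    rw [ih]
    rfl

theorem skelCon_le_ker_insertHom : SkelCon ≤ Con.ker insertHom := by
  refine Con.conGen_le.2 fun u v h => ?_
  obtain ⟨x, y, hxy, rfl, rfl⟩ := h.exists_disjoint
  rw [Con.ker_rel, map_mul, map_mul]
  funext w
  rcases hxy with h | h
  · exact insertLetter_comm_of_right_lt_left h w
  · exact (insertLetter_comm_of_right_lt_left h w).symm

theorem normalForm_eq_of_toSkel_eq {v w : List Letter} (h : toSkel v = toSkel w) :
    normalForm v = normalForm w := by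
  have := skelCon_le_ker_insertHom ((Con.eq SkelCon).1 h)
  rw [Con.ker_rel] at this
  rw [← insertHom_ofList_nil, ← insertHom_ofList_nil, this]

/-- Every element `m` of the trace monoid `M` has exactly one
representative word `w₀` in which all pairs of consecutive letters are allowed, and this
`w₀` is the lexicographically maximal representative of `m` with respect to the order
`c_1 < t_1 < c_2 < t_2 < ⋯`. -/
theorem unique_good_representative (m : SkelMonoid) :
    ∃ w₀ : List Letter, toSkel w₀ = m ∧ GoodWord w₀ ∧
      (∀ w : List Letter, toSkel w = m → GoodWord w → w = w₀) ∧
      (∀ w : List Letter, toSkel w = m → w = w₀ ∨ List.Lex LetterLT w w₀) := by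
  obtain ⟨v, rfl⟩ : ∃ v, toSkel v = m := SkelCon.mk'_surjective m
  refine ⟨normalForm v, toSkel_normalForm v, goodWord_normalForm v, fun w hw hg => ?_,
    fun w hw => ?_⟩
  · rw [← hg.normalForm_eq, normalForm_eq_of_toSkel_eq hw]
  · rw [← normalForm_eq_of_toSkel_eq hw]
    exact eq_or_lex_normalForm w
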